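/- Let α, β, γ > 0, δ ≥ 0 and ε ≥ 0. There exist constants C > 0 and ᾱ with 0 < ᾱ ≤ α such that the following holds. Let T > 0 and let u : ℝ³×[0,T] → ℝ³, σ : ℝ³×[0,T] → M₃(ℝ), p : ℝ³×[0,T] → ℝ and 𝓕 : ℝ³×[0,T] → ℝ³ be smooth and ℤ³-periodic in the space variable, with σ(x,t) symmetric for all (x,t), ∇·u(·,t) = 0 and ∫_{[0,1]³} u(x,t) dx = 0 for all t, satisfying pointwise the regularized Oldroyd-B system ∂ₜu = αΔu − (Ju·∇)u + β div(Jσ) − β∇p + β𝓕 and ∂ₜσ = εΔσ − (Ju·∇)σ + (∇Ju)σ + σ(∇Ju)ᵀ − γσ + δI. Then for every t ∈ [0,T]: ∫_{[0,1]³}|u(x,t)|² dx + 2ᾱ∫₀ᵗ∫_{[0,1]³}|∇u(x,s)|² dx ds + β∫_{[0,1]³} tr σ(x,t) dx + βγ∫₀ᵗ∫_{[0,1]³} tr σ(x,s) dx ds ≤ ∫_{[0,1]³}|u(x,0)|² dx + β∫_{[0,1]³} tr σ(x,0) dx + 3βδt + C∫₀ᵗ ‖𝓕(·,s)‖²_{L²}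 ds. -/

import Mathlib

open MeasureTheory

noncomputable section

abbrev V3 := Fin 3 → ℝ

/-- spatial partial derivative ∂ᵢf -/
def pd (i : Fin 3) (f : V3 → ℝ) (x : V3) : ℝ := fderiv ℝ f x (Pi.single i 1)

/-- Laplacian of a scalar function -/
def lap (f : V3 → ℝ) (x : V3) : ℝ := ∑ i, pd i (pd i f) x

/-- ℤ³-periodicity -/
def Periodic3 (f : V3 → ℝ) : Prop :=
  ∀ (x : V3) (k : Fin 3 → ℤ), f (x + fun i => (k i : ℝ)) = f x

/-- mollification Jf = η ∗ f -/
def J3 (η f : V3 → ℝ) (x : V3) : ℝ := ∫ y, η (x - y) * f y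

/-- curl ∇×u -/
def curl3 (u : V3 → V3) (x : V3) : V3 :=
  ![pd 1 (fun y => u y 2) x - pd 2 (fun y => u y 1) x,
    pd 2 (fun y => u y 0) x - pd 0 (fun y => u y 2) x,
    pd 0 (fun y => u y 1) x - pd 1 (fun y => u y 0) x]

/-- (v·∇)u -/
def advect (v u : V3 → V3) (x : V3) : V3 :=
  fun i => ∑ j, v x j * pd j (fun y => u y i) x

/-- the bilinear term Ω(v,u) -/
def Omg (v u : V3 → V3) (x : V3) : V3 :=
  ![∑ j, (pd 1 (fun y => v y j) x * pd j (fun y => u y 2) x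
      - pd 2 (fun y => v y j) x * pd j (fun y => u y 1) x),
    ∑ j, (pd 2 (fun y => v y j) x * pd j (fun y => u y 0) x
      - pd 0 (fun y => v y j) x * pd j (fun y => u y 2) x),
    ∑ j, (pd 0 (fun y => v y j) x * pd j (fun y => u y 1) x
      - pd 1 (fun y => v y j) x * pd j (fun y => u y 0) x)]

/-- `(u, σ, p, 𝓕)` is a smooth, ℤ³-periodic-in-space solution on ℝ³×[0,T] of the
regularized Oldroyd-B system
  ∂ₜu = αΔu − (Ju·∇)u + β div(Jσ) − β∇p + β𝓕,
  ∂ₜσ = εΔσ − (Ju·∇)σ + (∇Ju)σ + σ(∇Ju)ᵀ − γσ + δI,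
with σ symmetric, ∇·u = 0 and ∫_{[0,1]³} u dx = 0. -/
def IsRegOldroydBSolution (η : V3 → ℝ) (α β γ δ ε T : ℝ)
    (u : V3 → ℝ → V3) (σ : V3 → ℝ → Matrix (Fin 3) (Fin 3) ℝ)
    (p : V3 → ℝ → ℝ) (F : V3 → ℝ → V3) : Prop :=
  (∀ i, ContDiff ℝ (⊤:ℕ∞) (fun q : V3 × ℝ => u q.1 q.2 i)) ∧
  (∀ i j, ContDiff ℝ (⊤:ℕ∞) (fun q : V3 × ℝ => σ q.1 q.2 i j)) ∧
  ContDiff ℝ (⊤:ℕ∞) (fun q : V3 × ℝ => p q.1 q.2) ∧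
  (∀ i, ContDiff ℝ (⊤:ℕ∞) (fun q : V3 × ℝ => F q.1 q.2 i)) ∧
  (∀ t i, Periodic3 (fun x => u x t i)) ∧
  (∀ t i j, Periodic3 (fun x => σ x t i j)) ∧
  (∀ t, Periodic3 (fun x => p x t)) ∧
  (∀ t i, Periodic3 (fun x => F x t i)) ∧
  (∀ (x : V3) (t : ℝ), (σ x t).IsSymm) ∧
  (∀ (x : V3) (t : ℝ), (∑ i, pd i (fun y => u y t i) x) = 0) ∧
  (∀ t i, (∫ x in Set.Icc (0:V3) 1, u x t i) = 0) ∧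
  (∀ x : V3, ∀ t ∈ Set.Icc (0:ℝ) T, ∀ i,
    HasDerivWithinAt (fun s => u x s i)
      (α * lap (fun y => u y t i) x
        - (∑ j, J3 η (fun z => u z t j) x * pd j (fun y => u y t i) x)
        + β * (∑ j, pd j (J3 η (fun z => σ z t i j)) x)
        - β * pd i (fun y => p y t) x
        + β * F x t i)
      (Set.Icc (0:ℝ) T) t) ∧
  (∀ x : V3, ∀ t ∈ Set.Icc (0:ℝ) T, ∀ i j,
    HasDerivWithinAt (fun s => σ x s i j)
      (ε * lap (fun y => σ y t i j) x
        - (∑ k, J3 η (fun z => u z t k) x * pd k (fun y => σ y t i j) x)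
        + (∑ k, pd k (J3 η (fun z => u z t i)) x * σ x t k j)
        + (∑ k, σ x t i k * pd k (J3 η (fun z => u z t j)) x)
        - γ * σ x t i j
        + δ * (if i = j then (1:ℝ) else 0))
      (Set.Icc (0:ℝ) T) t)

/-- The energy inequality of Proposition 2.4 holds with constants C and ᾱ. -/
def EnergyInequality (η : V3 → ℝ) (α β γ δ ε C αbar : ℝ) : Prop :=
  ∀ T : ℝ, 0 < T →
  ∀ (u : V3 → ℝ → V3) (σ : V3 → ℝ → Matrix (Fin 3) (Fin 3) ℝ)
    (p : V3 → ℝ → ℝ) (F : V3 → ℝ → V3),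
    IsRegOldroydBSolution η α β γ δ ε T u σ p F →
    ∀ t ∈ Set.Icc (0:ℝ) T,
      (∫ x in Set.Icc (0:V3) 1, ∑ i, (u x t i)^2)
      + 2 * αbar * (∫ s in (0:ℝ)..t,
          ∫ x in Set.Icc (0:V3) 1, ∑ i, ∑ j, (pd j (fun y => u y s i) x)^2)
      + β * (∫ x in Set.Icc (0:V3) 1, ∑ i, σ x t i i)
      + β * γ * (∫ s in (0:ℝ)..t, ∫ x in Set.Icc (0:V3) 1, ∑ i, σ x s i i)
      ≤ (∫ x in Set.Icc (0:V3) 1, ∑ i, (u x 0 i)^2)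
        + β * (∫ x in Set.Icc (0:V3) 1, ∑ i, σ x 0 i i)
        + 3 * β * δ * t
        + C * (∫ s in (0:ℝ)..t, ∫ x in Set.Icc (0:V3) 1, ∑ i, (F x s i)^2)

/-! ### Integrals of periodic functions over the unit cube -/

lemma setIntegral_unitCube_add {g : V3 → ℝ} (hg : Periodic3 g) (h : V3) :
    ∫ x in Set.Icc (0 : V3) 1, g (x + h) = ∫ x in Set.Icc (0 : V3) 1, g x := by
  set b := Pi.basisFun ℝ (Fin 3)
  have hD := ZSpan.isAddFundamentalDomain b (volume : Measure V3)
  have hae : ZSpan.fundamentalDomain b =ᵐ[volume] Set.Icc (0 : V3) 1 := by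
    have : ZSpan.fundamentalDomain b =
        Set.univ.pi fun i : Fin 3 => Set.Ico ((0 : V3) i) ((1 : V3) i) := by
      ext x
      simp [ZSpan.mem_fundamentalDomain, b]
    rw [this]
    exact Measure.univ_pi_Ico_ae_eq_Icc
  have hinv : ∀ (k : Submodule.span ℤ (Set.range b)) (x : V3), g (k +ᵥ x) = g x := by
    intro k x
    have hk := (b.mem_span_iff_repr_mem ℤ (k : V3)).1 k.2
    choose m hm using hk
    have : (k : V3) = fun i => (m i : ℝ) := by
      ext i
      simpa [b] using (hm i).symm
    rw [Submodule.vadd_def, vadd_eq_add, this, add_comm]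
    exact hg x m
  have hvadd : VAddInvariantMeasure (Submodule.span ℤ (Set.range b)) V3 volume :=
    inferInstanceAs <|
      VAddInvariantMeasure (Submodule.span ℤ (Set.range b)).toAddSubgroup V3 volume
  have h1 := (hD.vadd_of_comm h).setIntegral_eq hD hinv
  rw [← setIntegral_congr_set hae, ← setIntegral_congr_set hae, ← h1, ← Set.image_vadd,
    (measurePreserving_vadd h (volume : Measure V3)).setIntegral_image_emb
      (measurableEmbedding_const_vadd h)]
  simp [add_comm]

lemma Continuous.integrableOn_unitCube {f : V3 → ℝ} (hf : Continuous f) :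
    Integrable f (volume.restrict (Set.Icc (0 : V3) 1)) :=
  hf.continuousOn.integrableOn_compact isCompact_Icc

lemma volume_real_unitCube : (volume : Measure V3).real (Set.Icc (0 : V3) 1) = 1 := by
  simp [Measure.real, Real.volume_Icc_pi]

lemma unitCube_intervalIntegral_swap {K : V3 → ℝ → ℝ} (hK : Continuous (Function.uncurry K))
    (a b : ℝ) :
    ∫ x in Set.Icc (0 : V3) 1, ∫ s in a..b, K x s
      = ∫ s in a..b, ∫ x in Set.Icc (0 : V3) 1, K x s := by
  symm
  apply intervalIntegral_integral_swap (f := fun s x => K x s)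
  rw [Measure.prod_restrict]
  refine IntegrableOn.mono_set ?_ (Set.prod_mono_left Set.uIoc_subset_uIcc)
  refine ContinuousOn.integrableOn_compact (isCompact_uIcc.prod isCompact_Icc) ?_
  exact (hK.comp continuous_swap).continuousOn

/-! ### Partial derivatives -/

lemma pd_eq {f : V3 → ℝ} {L : V3 →L[ℝ] ℝ} {x : V3} (h : HasFDerivAt f L x) (i : Fin 3) :
    pd i f x = L (Pi.single i 1) := by
  rw [pd, h.fderiv]

lemma Periodic3.pd {f : V3 → ℝ} (hf : Periodic3 f) (i : Fin 3) : Periodic3 (pd i f) := by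
  intro x k
  have : (fun y => f (y + fun i => (k i : ℝ))) = f := funext fun y => hf y k
  conv_rhs => rw [_root_.pd, ← this, fderiv_comp_add_right]
  rfl

lemma contDiff_pd {f : V3 → ℝ} (hf : ContDiff ℝ (⊤ : ℕ∞) f) (i : Fin 3) :
    ContDiff ℝ (⊤ : ℕ∞) (pd i f) :=
  (hf.fderiv_right (m := (⊤ : ℕ∞)) le_rfl).clm_apply contDiff_const

lemma pd_mul {f g : V3 → ℝ} (hf : ContDiff ℝ (⊤ : ℕ∞) f) (hg : ContDiff ℝ (⊤ : ℕ∞) g) (i : Fin 3)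
    (x : V3) : pd i (fun y => f y * g y) x = f x * pd i g x + pd i f x * g x := by
  have h1 := (hf.differentiable (by simp) x).hasFDerivAt
  have h2 := (hg.differentiable (by simp) x).hasFDerivAt
  rw [pd_eq (f := fun y => f y * g y) (h1.mul h2)]
  simp [pd, mul_comm]

lemma hasDerivAt_comp_line {f : V3 → ℝ} (hf : ContDiff ℝ (⊤ : ℕ∞) f) (x h : V3) (s : ℝ) :
    HasDerivAt (fun s : ℝ => f (x + s • h)) (∑ j, h j * pd j f (x + s • h)) s := by
  have h1 := (hf.differentiable (by simp) (x + s • h)).hasFDerivAt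
  have h2 : HasDerivAt (fun s : ℝ => x + s • h) h s := by
    simpa using ((hasDerivAt_id s).smul_const h).const_add x
  convert! h1.comp_hasDerivAt s h2 using 1
  conv_rhs => rw [pi_eq_sum_univ' h, map_sum]
  simp only [map_smul, smul_eq_mul]
  refine Finset.sum_congr rfl fun j _ => ?_
  congr 2
  ext i
  simp [Pi.single_apply]

lemma sub_eq_integral_line {f : V3 → ℝ} (hf : ContDiff ℝ (⊤ : ℕ∞) f) (x h : V3) :
    f (x + h) - f x = ∫ s in (0 : ℝ)..1, ∑ j, h j * pd j f (x + s • h) := by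
  have hc := fun j => (contDiff_pd hf j).continuous
  rw [intervalIntegral.integral_eq_sub_of_hasDerivAt fun s _ => hasDerivAt_comp_line hf x h s]
  · simp
  · exact Continuous.intervalIntegrable (by fun_prop) _ _

lemma integral_pd_eq_zero {f : V3 → ℝ} (hf : ContDiff ℝ (⊤ : ℕ∞) f) (hp : Periodic3 f)
    (i : Fin 3) : ∫ x in Set.Icc (0 : V3) 1, pd i f x = 0 := by
  have hc := (contDiff_pd hf i).continuous
  have h0 : ∀ x : V3, ∫ s in (0 : ℝ)..1, pd i f (x + s • Pi.single i 1) = 0 := by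
    intro x
    have h1 := sub_eq_integral_line hf x (Pi.single i 1)
    have h2 : f (x + Pi.single i 1) = f x := by
      convert! hp x (Pi.single i 1) using 3
      ext j
      simp [Pi.single_apply]
    simpa [h2, Pi.single_apply, eq_comm] using h1
  have h3 := unitCube_intervalIntegral_swap
    (K := fun x s => pd i f (x + s • Pi.single i 1)) (by fun_prop) 0 1
  simpa [h0, setIntegral_unitCube_add (hp.pd i)] using h3.symm

lemma integral_mul_pd {f g : V3 → ℝ} (hf : ContDiff ℝ (⊤ : ℕ∞) f) (hg : ContDiff ℝ (⊤ : ℕ∞) g)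
    (hfp : Periodic3 f) (hgp : Periodic3 g) (i : Fin 3) :
    ∫ x in Set.Icc (0 : V3) 1, f x * pd i g x = -∫ x in Set.Icc (0 : V3) 1, pd i f x * g x := by
  have h := integral_pd_eq_zero (hf.mul hg) (fun x k => by simp only [hfp x k, hgp x k]) i
  have hc1 := (contDiff_pd hf i).continuous
  have hc2 := (contDiff_pd hg i).continuous
  simp_rw [pd_mul hf hg i] at h
  rw [integral_add (Continuous.integrableOn_unitCube (by fun_prop))
    (Continuous.integrableOn_unitCube (by fun_prop))] at h
  linarith

lemma integral_transport_eq_zero {v : Fin 3 → V3 → ℝ} {g : V3 → ℝ}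
    (hv : ∀ j, ContDiff ℝ (⊤ : ℕ∞) (v j)) (hg : ContDiff ℝ (⊤ : ℕ∞) g)
    (hvp : ∀ j, Periodic3 (v j)) (hgp : Periodic3 g) (hdiv : ∀ x, ∑ j, pd j (v j) x = 0) :
    ∫ x in Set.Icc (0 : V3) 1, ∑ j, v j x * pd j g x = 0 := by
  have hc1 := fun j => (contDiff_pd (hv j) j).continuous
  have hc2 := fun j => (contDiff_pd hg j).continuous
  rw [integral_finsetSum _ fun j _ => Continuous.integrableOn_unitCube (by fun_prop)]
  simp_rw [fun j => integral_mul_pd (hv j) hg (hvp j) hgp j]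
  rw [Finset.sum_neg_distrib,
    ← integral_finsetSum _ fun j _ => Continuous.integrableOn_unitCube (by fun_prop)]
  simp [← Finset.sum_mul, hdiv]

/-! ### The Poincaré inequality on the torus -/

lemma sq_intervalIntegral_le {φ : ℝ → ℝ} (hφ : Continuous φ) :
    (∫ s in (0 : ℝ)..1, φ s) ^ 2 ≤ ∫ s in (0 : ℝ)..1, φ s ^ 2 := by
  set m := ∫ s in (0 : ℝ)..1, φ s
  have h : 0 ≤ ∫ s in (0 : ℝ)..1, (φ s ^ 2 - 2 * m * φ s + m ^ 2) :=
    intervalIntegral.integral_nonneg zero_le_one fun s _ => by nlinarith [sq_nonneg (φ s - m)]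
  rw [intervalIntegral.integral_add (Continuous.intervalIntegrable (by fun_prop) _ _)
      (Continuous.intervalIntegrable (by fun_prop) _ _),
    intervalIntegral.integral_sub (Continuous.intervalIntegrable (by fun_prop) _ _)
      (Continuous.intervalIntegrable (by fun_prop) _ _),
    intervalIntegral.integral_const_mul] at h
  simp only [intervalIntegral.integral_const, sub_zero, one_smul] at h
  change 0 ≤ _ - 2 * m * m + m ^ 2 at h
  linarith

lemma sq_sub_translate_le {f : V3 → ℝ} (hf : ContDiff ℝ (⊤ : ℕ∞) f) {h : V3}
    (hh : h ∈ Set.Icc (0 : V3) 1) (x : V3) :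
    (f (x + h) - f x) ^ 2 ≤ ∫ s in (0 : ℝ)..1, 3 * ∑ j, (pd j f (x + s • h)) ^ 2 := by
  have hc := fun j => (contDiff_pd hf j).continuous
  rw [sub_eq_integral_line hf]
  refine (sq_intervalIntegral_le (by fun_prop)).trans ?_
  refine intervalIntegral.integral_mono_on zero_le_one
    (Continuous.intervalIntegrable (by fun_prop) _ _)
    (Continuous.intervalIntegrable (by fun_prop) _ _) fun s _ => ?_
  refine (Finset.sum_mul_sq_le_sq_mul_sq _ _ _).trans ?_
  refine mul_le_mul_of_nonneg_right ?_ (Finset.sum_nonneg fun _ _ => sq_nonneg _)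
  calc ∑ i, h i ^ 2 ≤ ∑ _i : Fin 3, (1 : ℝ) :=
        Finset.sum_le_sum fun i _ => pow_le_one₀ (hh.1 i) (hh.2 i)
    _ = 3 := by simp

lemma integral_sq_sub_translate_le {f : V3 → ℝ} (hf : ContDiff ℝ (⊤ : ℕ∞) f) (hp : Periodic3 f)
    {h : V3} (hh : h ∈ Set.Icc (0 : V3) 1) :
    ∫ x in Set.Icc (0 : V3) 1, (f (x + h) - f x) ^ 2
      ≤ 3 * ∫ x in Set.Icc (0 : V3) 1, ∑ j, (pd j f x) ^ 2 := by
  have hcf := hf.continuous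
  have hc := fun j => (contDiff_pd hf j).continuous
  have hK : Continuous (Function.uncurry fun (x : V3) (s : ℝ) =>
      3 * ∑ j, (pd j f (x + s • h)) ^ 2) := by
    unfold Function.uncurry
    fun_prop
  calc _ ≤ ∫ x in Set.Icc (0 : V3) 1, ∫ s in (0 : ℝ)..1, 3 * ∑ j, (pd j f (x + s • h)) ^ 2 :=
        integral_mono (Continuous.integrableOn_unitCube (by fun_prop))
          (Continuous.integrableOn_unitCube
            (intervalIntegral.continuous_parametric_intervalIntegral_of_continuous' hK 0 1))
          fun x => sq_sub_translate_le hf hh x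
    _ = ∫ s in (0 : ℝ)..1, ∫ x in Set.Icc (0 : V3) 1, 3 * ∑ j, (pd j f (x + s • h)) ^ 2 :=
        unitCube_intervalIntegral_swap hK 0 1
    _ = ∫ _s in (0 : ℝ)..1, 3 * ∫ x in Set.Icc (0 : V3) 1, ∑ j, (pd j f x) ^ 2 := by
        congr 1
        ext s
        rw [integral_const_mul, setIntegral_unitCube_add (g := fun x => ∑ j, (pd j f x) ^ 2)]
        intro x k
        simp [fun j => hp.pd j x k]
    _ = _ := by simp

lemma integral_sq_le_integral_grad_sq {f : V3 → ℝ} (hf : ContDiff ℝ (⊤ : ℕ∞) f)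
    (hp : Periodic3 f) (hmean : ∫ x in Set.Icc (0 : V3) 1, f x = 0) :
    2 * ∫ x in Set.Icc (0 : V3) 1, f x ^ 2
      ≤ 3 * ∫ x in Set.Icc (0 : V3) 1, ∑ j, (pd j f x) ^ 2 := by
  have hcf := hf.continuous
  set A := ∫ x in Set.Icc (0 : V3) 1, f x ^ 2
  have hexp : ∀ h : V3, ∫ x in Set.Icc (0 : V3) 1, (f (x + h) - f x) ^ 2
      = 2 * A - 2 * ∫ x in Set.Icc (0 : V3) 1, f (x + h) * f x := by
    intro h
    have : ∀ x, (f (x + h) - f x) ^ 2 = (f (x + h) ^ 2 + f x ^ 2) - 2 * (f (x + h) * f x) :=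
      fun x => by ring
    simp_rw [this]
    rw [integral_sub (Continuous.integrableOn_unitCube (by fun_prop))
        (Continuous.integrableOn_unitCube (by fun_prop)),
      integral_add (Continuous.integrableOn_unitCube (by fun_prop))
        (Continuous.integrableOn_unitCube (by fun_prop)), integral_const_mul,
      setIntegral_unitCube_add (g := fun x => f x ^ 2) fun x k => by simp [hp x k]]
    ring
  have hcorr : ∫ h in Set.Icc (0 : V3) 1, ∫ x in Set.Icc (0 : V3) 1, f (x + h) * f x = 0 := by
    rw [integral_integral_swap]
    · have h0 : ∀ x : V3, ∫ h in Set.Icc (0 : V3) 1, f (x + h) * f x = 0 := by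
        intro x
        simp_rw [add_comm x]
        rw [integral_mul_const, setIntegral_unitCube_add hp, hmean, zero_mul]
      simp [h0]
    · rw [Measure.prod_restrict]
      refine ContinuousOn.integrableOn_compact (isCompact_Icc.prod isCompact_Icc) ?_
      unfold Function.uncurry
      fun_prop
  have hcont : Continuous fun h : V3 => ∫ x in Set.Icc (0 : V3) 1, f (x + h) * f x :=
    continuous_parametric_integral_of_continuous
      (by unfold Function.uncurry; fun_prop) isCompact_Icc
  have key : ∫ h in Set.Icc (0 : V3) 1,
      (2 * A - 2 * ∫ x in Set.Icc (0 : V3) 1, f (x + h) * f x)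
      ≤ ∫ _h in Set.Icc (0 : V3) 1, 3 * ∫ x in Set.Icc (0 : V3) 1, ∑ j, (pd j f x) ^ 2 :=
    setIntegral_mono_on (Continuous.integrableOn_unitCube (by fun_prop))
      (Continuous.integrableOn_unitCube (by fun_prop)) measurableSet_Icc fun h hh => by
        rw [← hexp]
        exact integral_sq_sub_translate_le hf hp hh
  rw [integral_sub (Continuous.integrableOn_unitCube (by fun_prop))
    (Continuous.integrableOn_unitCube (by fun_prop)), integral_const_mul 2
      (fun h : V3 => ∫ x in Set.Icc (0 : V3) 1, f (x + h) * f x), hcorr] at key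
  simpa [volume_real_unitCube] using key

/-! ### Mollification -/

lemma J3_eq_convolution (η f : V3 → ℝ) :
    J3 η f = convolution η f (ContinuousLinearMap.mul ℝ ℝ) volume := by
  ext x
  rw [convolution_eq_swap]
  rfl

lemma J3_eq_integral_mul_sub (η f : V3 → ℝ) (x : V3) : J3 η f x = ∫ z, η z * f (x - z) := by
  rw [J3, ← integral_sub_left_eq_self _ volume x]
  simp

lemma J3_eq_integral_mul_add (η f : V3 → ℝ) (x : V3) : J3 η f x = ∫ z, η (-z) * f (x + z) := by
  rw [J3, ← integral_add_left_eq_self _ x]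
  simp

lemma contDiff_J3 {η f : V3 → ℝ} (hη : ContDiff ℝ (⊤ : ℕ∞) η) (hs : HasCompactSupport η)
    (hf : Continuous f) : ContDiff ℝ (⊤ : ℕ∞) (J3 η f) := by
  rw [J3_eq_convolution]
  exact hs.contDiff_convolution_left _ hη hf.locallyIntegrable

lemma Periodic3.J3 {f : V3 → ℝ} (hf : Periodic3 f) (η : V3 → ℝ) : Periodic3 (J3 η f) := by
  intro x k
  simp_rw [J3_eq_integral_mul_sub, add_sub_right_comm]
  exact integral_congr_ae (.of_forall fun z => by simp only [hf (x - z) k])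

lemma hasCompactSupport_pd {η : V3 → ℝ} (hs : HasCompactSupport η) (i : Fin 3) :
    HasCompactSupport (pd i η) :=
  hs.fderiv_apply (𝕜 := ℝ) _

lemma integrable_kernel_mul {K f : V3 → ℝ} (hK : Continuous K) (hs : HasCompactSupport K)
    (hf : Continuous f) (x : V3) : Integrable fun y => K (x - y) * f y := by
  refine Continuous.integrable_of_hasCompactSupport (by fun_prop) ?_
  exact (hs.comp_homeomorph (Homeomorph.subLeft x)).mul_right

lemma pd_J3 {η f : V3 → ℝ} (hη : ContDiff ℝ (⊤ : ℕ∞) η) (hs : HasCompactSupport η)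
    (hf : Continuous f) (i : Fin 3) (x : V3) : pd i (J3 η f) x = J3 (pd i η) f x := by
  have h := hs.hasFDerivAt_convolution_left (ContinuousLinearMap.mul ℝ ℝ) (hη.of_le (by simp))
    hf.locallyIntegrable (μ := volume) x
  rw [J3_eq_convolution, pd_eq h, J3_eq_convolution, convolution_def,
    ContinuousLinearMap.integral_apply]
  · rfl
  · exact ((hs.fderiv ℝ).convolutionExists_left _ (hη.continuous_fderiv (by simp))
      hf.locallyIntegrable x)

lemma J3_pd {η f : V3 → ℝ} (hη : ContDiff ℝ (⊤ : ℕ∞) η) (hs : HasCompactSupport η)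
    (hf : ContDiff ℝ (⊤ : ℕ∞) f) (i : Fin 3) (x : V3) : J3 (pd i η) f x = J3 η (pd i f) x := by
  have hd : ∀ y, fderiv ℝ (fun y => η (x - y)) y (Pi.single i 1) = -pd i η (x - y) := by
    intro y
    have h1 := (hη.differentiable (by simp) (x - y)).hasFDerivAt
    have h2 : HasFDerivAt (fun y => η (x - y)) _ y :=
      h1.comp y ((hasFDerivAt_id y).const_sub x)
    rw [h2.fderiv]
    simp [pd]
  have h := integral_mul_fderiv_eq_neg_fderiv_mul_of_integrable (μ := (volume : Measure V3))
    (f := fun y => η (x - y)) (g := f) (v := Pi.single i 1) ?_ ?_ ?_ ?_ ?_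
  · simp only [hd, neg_mul, integral_neg, neg_neg] at h
    exact h.symm
  · simp only [hd, neg_mul]
    exact (integrable_kernel_mul (contDiff_pd hη i).continuous (hasCompactSupport_pd hs i)
      hf.continuous x).neg
  · exact integrable_kernel_mul hη.continuous hs (contDiff_pd hf i).continuous x
  · exact integrable_kernel_mul hη.continuous hs hf.continuous x
  · exact fun y _ => (hη.differentiable (by simp) _).comp y (by fun_prop)
  · exact fun y _ => hf.differentiable (by simp) y

lemma sum_pd_J3_eq_zero {η : V3 → ℝ} (hη : ContDiff ℝ (⊤ : ℕ∞) η) (hs : HasCompactSupport η)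
    {U : Fin 3 → V3 → ℝ} (hU : ∀ j, ContDiff ℝ (⊤ : ℕ∞) (U j))
    (hdiv : ∀ x, ∑ j, pd j (U j) x = 0) (x : V3) : ∑ j, pd j (J3 η (U j)) x = 0 := by
  simp_rw [fun j => pd_J3 hη hs (hU j).continuous j, fun j => J3_pd hη hs (hU j) j, J3]
  rw [← integral_finsetSum _ fun j _ =>
    integrable_kernel_mul hη.continuous hs (contDiff_pd (hU j) j).continuous x]
  simp [← Finset.mul_sum, hdiv]

lemma integrable_unitCube_prod_kernel {K : V3 → ℝ} (hK : Continuous K) (hs : HasCompactSupport K)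
    {F : V3 → V3 → ℝ} (hF : Continuous (Function.uncurry F)) :
    Integrable (Function.uncurry fun x z => K z * F x z)
      ((volume.restrict (Set.Icc (0 : V3) 1)).prod (volume : Measure V3)) := by
  have h : IntegrableOn (Function.uncurry fun x z => K z * F x z)
      (Set.Icc (0 : V3) 1 ×ˢ Set.univ) ((volume : Measure V3).prod (volume : Measure V3)) := by
    refine IntegrableOn.of_forall_sdiff_eq_zero (s := Set.Icc (0 : V3) 1 ×ˢ tsupport K) ?_
      (measurableSet_Icc.prod .univ) ?_
    · refine ContinuousOn.integrableOn_compact (isCompact_Icc.prod hs) ?_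
      exact ((hK.comp continuous_snd).mul hF).continuousOn
    · rintro ⟨x, z⟩ ⟨⟨hx, -⟩, hz⟩
      have : z ∉ tsupport K := fun h => hz ⟨hx, h⟩
      simp [image_eq_zero_of_notMem_tsupport this]
  rwa [IntegrableOn, ← Measure.prod_restrict, Measure.restrict_univ] at h

lemma integral_mul_J3_of_parity {K : V3 → ℝ} (hK : Continuous K) (hs : HasCompactSupport K)
    {c : ℝ} (hc : ∀ x, K (-x) = c * K x) {f g : V3 → ℝ} (hf : Continuous f) (hg : Continuous g)
    (hfp : Periodic3 f) (hgp : Periodic3 g) :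
    ∫ x in Set.Icc (0 : V3) 1, g x * J3 K f x
      = c * ∫ x in Set.Icc (0 : V3) 1, J3 K g x * f x := by
  have h1 : ∀ x, g x * J3 K f x = ∫ z, K z * (g x * f (x - z)) := by
    intro x
    rw [J3_eq_integral_mul_sub, ← integral_const_mul]
    congr 1
    ext z
    ring
  have h2 : ∀ x, J3 K g x * f x = c * ∫ z, K z * (g (x + z) * f x) := by
    intro x
    rw [J3_eq_integral_mul_add, ← integral_mul_const, ← integral_const_mul]
    congr 1
    ext z
    rw [hc]
    ring
  have hcc : c * c * ∫ x in Set.Icc (0 : V3) 1, ∫ z, K z * (g (x + z) * f x)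
      = ∫ x in Set.Icc (0 : V3) 1, ∫ z, K z * (g (x + z) * f x) := by
    have : ∀ z, c * c * K z = K z := fun z => by
      rw [mul_assoc, ← hc, ← hc, neg_neg]
    simp_rw [← integral_const_mul, ← mul_assoc, this]
  simp_rw [h1, h2]
  rw [integral_const_mul, ← mul_assoc, hcc,
    integral_integral_swap (integrable_unitCube_prod_kernel hK hs (F := fun x z => g x * f (x - z))
      (by unfold Function.uncurry; fun_prop)),
    integral_integral_swap (integrable_unitCube_prod_kernel hK hs (F := fun x z => g (x + z) * f x)
      (by unfold Function.uncurry; fun_prop))]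
  congr 1
  ext z
  rw [integral_const_mul, integral_const_mul,
    ← setIntegral_unitCube_add (g := fun x => g x * f (x - z)) _ z]
  · simp
  · intro x k
    simp only [add_sub_right_comm, hgp x k, hfp (x - z) k]

lemma integral_mul_pd_J3 {η : V3 → ℝ} (hη : ContDiff ℝ (⊤ : ℕ∞) η) (hs : HasCompactSupport η)
    (heven : ∀ x, η (-x) = η x) {f g : V3 → ℝ} (hf : Continuous f) (hg : Continuous g)
    (hfp : Periodic3 f) (hgp : Periodic3 g) (i : Fin 3) :
    ∫ x in Set.Icc (0 : V3) 1, g x * pd i (J3 η f) x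
      = -∫ x in Set.Icc (0 : V3) 1, pd i (J3 η g) x * f x := by
  have hodd : ∀ x, pd i η (-x) = -1 * pd i η x := by
    intro x
    have h1 : HasFDerivAt (fun y => η (-y)) _ x :=
      (hη.differentiable (by simp) (-x)).hasFDerivAt.comp x (hasFDerivAt_id x).neg
    simp only [heven] at h1
    rw [pd_eq h1]
    simp [pd]
  simp_rw [pd_J3 hη hs hf, pd_J3 hη hs hg]
  rw [integral_mul_J3_of_parity (contDiff_pd hη i).continuous (hasCompactSupport_pd hs i) hodd
    hf hg hfp hgp, neg_one_mul]

/-! ### The energy balance at a fixed time -/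

lemma integral_mul_lap {f : V3 → ℝ} (hf : ContDiff ℝ (⊤ : ℕ∞) f) (hp : Periodic3 f) :
    ∫ x in Set.Icc (0 : V3) 1, f x * lap f x = -∫ x in Set.Icc (0 : V3) 1, ∑ j, pd j f x ^ 2 := by
  have hc := fun j => (contDiff_pd hf j).continuous
  have hc2 := fun j => (contDiff_pd (contDiff_pd hf j) j).continuous
  have hcf := hf.continuous
  simp_rw [lap, Finset.mul_sum]
  rw [integral_finsetSum _ fun j _ => Continuous.integrableOn_unitCube (by fun_prop),
    integral_finsetSum _ fun j _ => Continuous.integrableOn_unitCube (by fun_prop),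
    ← Finset.sum_neg_distrib]
  refine Finset.sum_congr rfl fun j _ => ?_
  rw [integral_mul_pd hf (contDiff_pd hf j) hp (hp.pd j)]
  simp_rw [sq]

lemma integral_lap_eq_zero {f : V3 → ℝ} (hf : ContDiff ℝ (⊤ : ℕ∞) f) (hp : Periodic3 f) :
    ∫ x in Set.Icc (0 : V3) 1, lap f x = 0 := by
  have hc2 := fun j => (contDiff_pd (contDiff_pd hf j) j).continuous
  simp_rw [lap]
  rw [integral_finsetSum _ fun j _ => Continuous.integrableOn_unitCube (by fun_prop)]
  exact Finset.sum_eq_zero fun j _ => integral_pd_eq_zero (contDiff_pd hf j) (hp.pd j) j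

lemma integral_mul_transport_eq_zero {v : Fin 3 → V3 → ℝ} {g : V3 → ℝ}
    (hv : ∀ j, ContDiff ℝ (⊤ : ℕ∞) (v j)) (hg : ContDiff ℝ (⊤ : ℕ∞) g)
    (hvp : ∀ j, Periodic3 (v j)) (hgp : Periodic3 g) (hdiv : ∀ x, ∑ j, pd j (v j) x = 0) :
    ∫ x in Set.Icc (0 : V3) 1, g x * ∑ j, v j x * pd j g x = 0 := by
  have h := integral_transport_eq_zero hv (hg.mul hg) hvp
    (fun x k => by simp only [hgp x k]) hdiv
  simp_rw [pd_mul hg hg] at h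
  have h2 : ∀ x, ∑ j, v j x * (g x * pd j g x + pd j g x * g x)
      = 2 * (g x * ∑ j, v j x * pd j g x) := by
    intro x
    rw [Finset.mul_sum, Finset.mul_sum]
    exact Finset.sum_congr rfl fun j _ => by ring
  simp_rw [h2, integral_const_mul] at h
  linarith

/-- The production of kinetic and elastic energy by the stress cancel after integration. -/
lemma integral_stress_power {η : V3 → ℝ} (hη : ContDiff ℝ (⊤ : ℕ∞) η) (hs : HasCompactSupport η)
    (heven : ∀ x, η (-x) = η x) {U : Fin 3 → V3 → ℝ} {S : Fin 3 → Fin 3 → V3 → ℝ}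
    (hU : ∀ i, Continuous (U i)) (hS : ∀ i j, Continuous (S i j))
    (hUp : ∀ i, Periodic3 (U i)) (hSp : ∀ i j, Periodic3 (S i j)) :
    ∫ x in Set.Icc (0 : V3) 1, ∑ i, U i x * ∑ j, pd j (J3 η (S i j)) x
      = -∫ x in Set.Icc (0 : V3) 1, ∑ i, ∑ j, pd j (J3 η (U i)) x * S i j x := by
  have hc1 := fun i j => (contDiff_pd (contDiff_J3 hη hs (hU i)) j).continuous
  have hc2 := fun i j => (contDiff_pd (contDiff_J3 hη hs (hS i j)) j).continuous
  simp_rw [Finset.mul_sum]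
  rw [integral_finsetSum _ fun i _ => Continuous.integrableOn_unitCube (by fun_prop),
    integral_finsetSum _ fun i _ => Continuous.integrableOn_unitCube (by fun_prop),
    ← Finset.sum_neg_distrib]
  refine Finset.sum_congr rfl fun i _ => ?_
  rw [integral_finsetSum _ fun j _ => Continuous.integrableOn_unitCube (by fun_prop),
    integral_finsetSum _ fun j _ => Continuous.integrableOn_unitCube (by fun_prop),
    ← Finset.sum_neg_distrib]
  exact Finset.sum_congr rfl fun j _ =>
    integral_mul_pd_J3 hη hs heven (hS i j) (hU i) (hSp i j) (hUp i) j

/-- The right-hand side of the velocity equation. -/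
def velocityRHS (η : V3 → ℝ) (α β : ℝ) (U : Fin 3 → V3 → ℝ) (S : Fin 3 → Fin 3 → V3 → ℝ)
    (P : V3 → ℝ) (G : Fin 3 → V3 → ℝ) (i : Fin 3) (x : V3) : ℝ :=
  α * lap (U i) x - (∑ j, J3 η (U j) x * pd j (U i) x) + β * (∑ j, pd j (J3 η (S i j)) x)
    - β * pd i P x + β * G i x

/-- The diagonal entries of the right-hand side of the stress equation. -/
def stressDiagRHS (η : V3 → ℝ) (γ δ ε : ℝ) (U : Fin 3 → V3 → ℝ) (S : Fin 3 → Fin 3 → V3 → ℝ)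
    (i : Fin 3) (x : V3) : ℝ :=
  ε * lap (S i i) x - (∑ k, J3 η (U k) x * pd k (S i i) x)
    + (∑ k, pd k (J3 η (U i)) x * S k i x) + (∑ k, S i k x * pd k (J3 η (U i)) x)
    - γ * S i i x + δ

lemma integral_velocityRHS {η : V3 → ℝ} (hη : ContDiff ℝ (⊤ : ℕ∞) η) (hs : HasCompactSupport η)
    (heven : ∀ x, η (-x) = η x) (α β : ℝ) {U : Fin 3 → V3 → ℝ} {S : Fin 3 → Fin 3 → V3 → ℝ}
    {P : V3 → ℝ} {G : Fin 3 → V3 → ℝ}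
    (hU : ∀ i, ContDiff ℝ (⊤ : ℕ∞) (U i)) (hS : ∀ i j, ContDiff ℝ (⊤ : ℕ∞) (S i j))
    (hP : ContDiff ℝ (⊤ : ℕ∞) P) (hG : ∀ i, Continuous (G i))
    (hUp : ∀ i, Periodic3 (U i)) (hSp : ∀ i j, Periodic3 (S i j)) (hPp : Periodic3 P)
    (hdiv : ∀ x, ∑ i, pd i (U i) x = 0) :
    ∫ x in Set.Icc (0 : V3) 1, ∑ i, 2 * U i x * velocityRHS η α β U S P G i x
      = -(2 * α * ∫ x in Set.Icc (0 : V3) 1, ∑ i, ∑ j, pd j (U i) x ^ 2)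
        - 2 * β * (∫ x in Set.Icc (0 : V3) 1, ∑ i, ∑ j, pd j (J3 η (U i)) x * S i j x)
        + 2 * β * ∫ x in Set.Icc (0 : V3) 1, ∑ i, U i x * G i x := by
  have hJ := fun i => contDiff_J3 hη hs (hU i).continuous
  have c1 := fun i => (hU i).continuous
  have c2 := fun i => (hJ i).continuous
  have c3 := fun i j => (contDiff_pd (hU i) j).continuous
  have c4 := fun i j => (contDiff_pd (contDiff_J3 hη hs (hS i j).continuous) j).continuous
  have c5 := fun i => (contDiff_pd hP i).continuous
  have c6 : ∀ i, Continuous (lap (U i)) := fun i =>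
    continuous_finsetSum _ fun j _ => (contDiff_pd (contDiff_pd (hU i) j) j).continuous
  have hexp : ∀ x, ∑ i, 2 * U i x * velocityRHS η α β U S P G i x
      = 2 * α * (∑ i, U i x * lap (U i) x) - 2 * (∑ i, U i x * ∑ j, J3 η (U j) x * pd j (U i) x)
        + 2 * β * (∑ i, U i x * ∑ j, pd j (J3 η (S i j)) x) - 2 * β * (∑ i, U i x * pd i P x)
        + 2 * β * ∑ i, U i x * G i x := by
    intro x
    simp only [Finset.mul_sum (Finset.univ : Finset (Fin 3)) (fun i => U i x * _),
      ← Finset.sum_sub_distrib, ← Finset.sum_add_distrib]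
    exact Finset.sum_congr rfl fun i _ => by rw [velocityRHS]; ring
  have hlap : ∫ x in Set.Icc (0 : V3) 1, ∑ i, U i x * lap (U i) x
      = -∫ x in Set.Icc (0 : V3) 1, ∑ i, ∑ j, pd j (U i) x ^ 2 := by
    rw [integral_finsetSum _ fun i _ => Continuous.integrableOn_unitCube (by fun_prop),
      integral_finsetSum _ fun i _ => Continuous.integrableOn_unitCube (by fun_prop),
      ← Finset.sum_neg_distrib]
    exact Finset.sum_congr rfl fun i _ => integral_mul_lap (hU i) (hUp i)
  have hadv : ∫ x in Set.Icc (0 : V3) 1, ∑ i, U i x * ∑ j, J3 η (U j) x * pd j (U i) x = 0 := by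
    rw [integral_finsetSum _ fun i _ => Continuous.integrableOn_unitCube (by fun_prop)]
    exact Finset.sum_eq_zero fun i _ => integral_mul_transport_eq_zero hJ (hU i)
      (fun j => (hUp j).J3 η) (hUp i) (sum_pd_J3_eq_zero hη hs hU hdiv)
  simp_rw [hexp]
  rw [integral_add (Continuous.integrableOn_unitCube (by fun_prop))
      (Continuous.integrableOn_unitCube (by fun_prop)),
    integral_sub (Continuous.integrableOn_unitCube (by fun_prop))
      (Continuous.integrableOn_unitCube (by fun_prop)),
    integral_add (Continuous.integrableOn_unitCube (by fun_prop))
      (Continuous.integrableOn_unitCube (by fun_prop)),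
    integral_sub (Continuous.integrableOn_unitCube (by fun_prop))
      (Continuous.integrableOn_unitCube (by fun_prop))]
  simp only [integral_const_mul]
  rw [hlap, hadv, integral_transport_eq_zero hU hP hUp hPp hdiv,
    integral_stress_power hη hs heven c1 (fun i j => (hS i j).continuous) hUp hSp]
  ring

lemma integral_stressDiagRHS {η : V3 → ℝ} (hη : ContDiff ℝ (⊤ : ℕ∞) η)
    (hs : HasCompactSupport η) (γ δ ε : ℝ)
    {U : Fin 3 → V3 → ℝ} {S : Fin 3 → Fin 3 → V3 → ℝ}
    (hU : ∀ i, ContDiff ℝ (⊤ : ℕ∞) (U i)) (hS : ∀ i j, ContDiff ℝ (⊤ : ℕ∞) (S i j))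
    (hUp : ∀ i, Periodic3 (U i)) (hSp : ∀ i j, Periodic3 (S i j))
    (hsymm : ∀ i j x, S i j x = S j i x) (hdiv : ∀ x, ∑ i, pd i (U i) x = 0) :
    ∫ x in Set.Icc (0 : V3) 1, ∑ i, stressDiagRHS η γ δ ε U S i x
      = 2 * (∫ x in Set.Icc (0 : V3) 1, ∑ i, ∑ j, pd j (J3 η (U i)) x * S i j x)
        - γ * (∫ x in Set.Icc (0 : V3) 1, ∑ i, S i i x) + 3 * δ := by
  have hJ := fun i => contDiff_J3 hη hs (hU i).continuous
  have c1 := fun i j => (hS i j).continuous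
  have c2 := fun i => (hJ i).continuous
  have c3 := fun i j => (contDiff_pd (hJ i) j).continuous
  have c4 := fun i k => (contDiff_pd (hS i i) k).continuous
  have c6 : ∀ i, Continuous (lap (S i i)) := fun i =>
    continuous_finsetSum _ fun j _ => (contDiff_pd (contDiff_pd (hS i i) j) j).continuous
  have hexp : ∀ x, ∑ i, stressDiagRHS η γ δ ε U S i x
      = ε * (∑ i, lap (S i i) x) - (∑ i, ∑ k, J3 η (U k) x * pd k (S i i) x)
        + 2 * (∑ i, ∑ j, pd j (J3 η (U i)) x * S i j x) - γ * (∑ i, S i i x) + 3 * δ := by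
    intro x
    have h3 : 3 * δ = ∑ _i : Fin 3, δ := by simp
    rw [h3, Finset.mul_sum, Finset.mul_sum, Finset.mul_sum, ← Finset.sum_sub_distrib,
      ← Finset.sum_add_distrib, ← Finset.sum_sub_distrib, ← Finset.sum_add_distrib]
    refine Finset.sum_congr rfl fun i _ => ?_
    have h1 : ∑ k, pd k (J3 η (U i)) x * S k i x = ∑ k, pd k (J3 η (U i)) x * S i k x :=
      Finset.sum_congr rfl fun k _ => by rw [hsymm k i]
    have h2 : ∑ k, S i k x * pd k (J3 η (U i)) x = ∑ k, pd k (J3 η (U i)) x * S i k x :=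
      Finset.sum_congr rfl fun k _ => mul_comm _ _
    rw [stressDiagRHS, h1, h2]
    ring
  have hlap : ∫ x in Set.Icc (0 : V3) 1, ∑ i, lap (S i i) x = 0 := by
    rw [integral_finsetSum _ fun i _ => Continuous.integrableOn_unitCube (by fun_prop)]
    exact Finset.sum_eq_zero fun i _ => integral_lap_eq_zero (hS i i) (hSp i i)
  have hadv : ∫ x in Set.Icc (0 : V3) 1, ∑ i, ∑ k, J3 η (U k) x * pd k (S i i) x = 0 := by
    rw [integral_finsetSum _ fun i _ => Continuous.integrableOn_unitCube (by fun_prop)]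
    exact Finset.sum_eq_zero fun i _ => integral_transport_eq_zero hJ (hS i i)
      (fun j => (hUp j).J3 η) (hSp i i) (sum_pd_J3_eq_zero hη hs hU hdiv)
  simp_rw [hexp]
  rw [integral_add (Continuous.integrableOn_unitCube (by fun_prop))
      (Continuous.integrableOn_unitCube (by fun_prop)),
    integral_sub (Continuous.integrableOn_unitCube (by fun_prop))
      (Continuous.integrableOn_unitCube (by fun_prop)),
    integral_add (Continuous.integrableOn_unitCube (by fun_prop))
      (Continuous.integrableOn_unitCube (by fun_prop)),
    integral_sub (Continuous.integrableOn_unitCube (by fun_prop))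
      (Continuous.integrableOn_unitCube (by fun_prop))]
  simp only [integral_const_mul]
  rw [hlap, hadv]
  simp [volume_real_unitCube]

lemma integral_force_power_le {α β : ℝ} (hα : 0 < α) {U G : Fin 3 → V3 → ℝ}
    (hU : ∀ i, ContDiff ℝ (⊤ : ℕ∞) (U i)) (hG : ∀ i, Continuous (G i))
    (hUp : ∀ i, Periodic3 (U i)) (hmean : ∀ i, ∫ x in Set.Icc (0 : V3) 1, U i x = 0) :
    2 * β * (∫ x in Set.Icc (0 : V3) 1, ∑ i, U i x * G i x)
      ≤ α * (∫ x in Set.Icc (0 : V3) 1, ∑ i, ∑ j, pd j (U i) x ^ 2)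
        + 3 * β ^ 2 / (2 * α) * ∫ x in Set.Icc (0 : V3) 1, ∑ i, G i x ^ 2 := by
  have c1 := fun i => (hU i).continuous
  have c3 := fun i j => (contDiff_pd (hU i) j).continuous
  have hP : 2 * (∫ x in Set.Icc (0 : V3) 1, ∑ i, U i x ^ 2)
      ≤ 3 * ∫ x in Set.Icc (0 : V3) 1, ∑ i, ∑ j, pd j (U i) x ^ 2 := by
    rw [integral_finsetSum _ fun i _ => Continuous.integrableOn_unitCube (by fun_prop),
      integral_finsetSum _ fun i _ => Continuous.integrableOn_unitCube (by fun_prop),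
      Finset.mul_sum, Finset.mul_sum]
    exact Finset.sum_le_sum fun i _ =>
      integral_sq_le_integral_grad_sq (hU i) (hUp i) (hmean i)
  have hY : 2 * β * (∫ x in Set.Icc (0 : V3) 1, ∑ i, U i x * G i x)
      ≤ 2 * α / 3 * (∫ x in Set.Icc (0 : V3) 1, ∑ i, U i x ^ 2)
        + 3 * β ^ 2 / (2 * α) * ∫ x in Set.Icc (0 : V3) 1, ∑ i, G i x ^ 2 := by
    rw [← integral_const_mul, ← integral_const_mul, ← integral_const_mul,
      ← integral_add (Continuous.integrableOn_unitCube (by fun_prop))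
        (Continuous.integrableOn_unitCube (by fun_prop))]
    refine integral_mono (Continuous.integrableOn_unitCube (by fun_prop))
      (Continuous.integrableOn_unitCube (by fun_prop)) fun x => ?_
    simp only [Finset.mul_sum]
    rw [← Finset.sum_add_distrib]
    refine Finset.sum_le_sum fun i _ => ?_
    have h : 2 * α / 3 * U i x ^ 2 + 3 * β ^ 2 / (2 * α) * G i x ^ 2 - 2 * β * (U i x * G i x)
        = 2 * α / 3 * (U i x - 3 * β / (2 * α) * G i x) ^ 2 := by
      field_simp
      ring
    have h' : 0 ≤ 2 * α / 3 * (U i x - 3 * β / (2 * α) * G i x) ^ 2 := by positivity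
    linarith
  nlinarith [mul_le_mul_of_nonneg_left hP hα.le]

lemma energy_dissipation {η : V3 → ℝ} (hη : ContDiff ℝ (⊤ : ℕ∞) η) (hs : HasCompactSupport η)
    (heven : ∀ x, η (-x) = η x) {α : ℝ} (β γ δ ε : ℝ) (hα : 0 < α)
    {U : Fin 3 → V3 → ℝ} {S : Fin 3 → Fin 3 → V3 → ℝ} {P : V3 → ℝ} {G : Fin 3 → V3 → ℝ}
    (hU : ∀ i, ContDiff ℝ (⊤ : ℕ∞) (U i)) (hS : ∀ i j, ContDiff ℝ (⊤ : ℕ∞) (S i j))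
    (hP : ContDiff ℝ (⊤ : ℕ∞) P) (hG : ∀ i, Continuous (G i))
    (hUp : ∀ i, Periodic3 (U i)) (hSp : ∀ i j, Periodic3 (S i j)) (hPp : Periodic3 P)
    (hsymm : ∀ i j x, S i j x = S j i x) (hdiv : ∀ x, ∑ i, pd i (U i) x = 0)
    (hmean : ∀ i, ∫ x in Set.Icc (0 : V3) 1, U i x = 0) :
    (∫ x in Set.Icc (0 : V3) 1, ∑ i, 2 * U i x * velocityRHS η α β U S P G i x)
        + β * (∫ x in Set.Icc (0 : V3) 1, ∑ i, stressDiagRHS η γ δ ε U S i x)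
      ≤ -(α * ∫ x in Set.Icc (0 : V3) 1, ∑ i, ∑ j, pd j (U i) x ^ 2)
        - β * γ * (∫ x in Set.Icc (0 : V3) 1, ∑ i, S i i x) + 3 * β * δ
        + 3 * β ^ 2 / (2 * α) * ∫ x in Set.Icc (0 : V3) 1, ∑ i, G i x ^ 2 := by
  rw [integral_velocityRHS hη hs heven α β hU hS hP hG hUp hSp hPp hdiv,
    integral_stressDiagRHS hη hs γ δ ε hU hS hUp hSp hsymm hdiv]
  linarith [integral_force_power_le (β := β) hα hU hG hUp hmean]

/-! ### Smooth functions of space and time -/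

lemma hasDerivAt_time {f : V3 → ℝ → ℝ} (hf : ContDiff ℝ (⊤ : ℕ∞) fun q : V3 × ℝ => f q.1 q.2)
    (x : V3) (s : ℝ) : HasDerivAt (f x) (deriv (f x) s) s := by
  have : Differentiable ℝ (f x) :=
    (hf.comp (contDiff_prodMk_right x)).differentiable (by simp)
  exact (this s).hasDerivAt

lemma continuous_deriv_time {f : V3 → ℝ → ℝ}
    (hf : ContDiff ℝ (⊤ : ℕ∞) fun q : V3 × ℝ => f q.1 q.2) :
    Continuous fun q : V3 × ℝ => deriv (f q.1) q.2 := by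
  have h : ∀ q : V3 × ℝ, deriv (f q.1) q.2
      = fderiv ℝ (fun q : V3 × ℝ => f q.1 q.2) q ((0 : V3), (1 : ℝ)) := by
    intro q
    have h1 := (hf.differentiable (by simp) q).hasFDerivAt
    exact (h1.comp_hasDerivAt q.2 ((hasDerivAt_const q.2 q.1).prodMk (hasDerivAt_id q.2))).deriv
  simp_rw [h]
  exact (hf.continuous_fderiv (by simp)).clm_apply continuous_const

lemma contDiff_slice {f : V3 → ℝ → ℝ} (hf : ContDiff ℝ (⊤ : ℕ∞) fun q : V3 × ℝ => f q.1 q.2)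
    (s : ℝ) : ContDiff ℝ (⊤ : ℕ∞) fun x => f x s :=
  hf.comp (contDiff_prodMk_left s)

lemma continuous_pd_slice {f : V3 → ℝ → ℝ}
    (hf : ContDiff ℝ (⊤ : ℕ∞) fun q : V3 × ℝ => f q.1 q.2) (j : Fin 3) :
    Continuous fun q : V3 × ℝ => pd j (fun y => f y q.2) q.1 := by
  have h : ∀ q : V3 × ℝ, pd j (fun y => f y q.2) q.1
      = fderiv ℝ (fun q : V3 × ℝ => f q.1 q.2) q ((Pi.single j 1 : V3), (0 : ℝ)) := by
    intro q
    have h1 := (hf.differentiable (by simp) q).hasFDerivAt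
    have h2 := HasFDerivAt.comp (f := fun y : V3 => (y, q.2)) (g := fun q : V3 × ℝ => f q.1 q.2)
      q.1 h1 (hasFDerivAt_prodMk_left q.1 q.2)
    exact (pd_eq h2 j).trans (by simp)
  simp_rw [h]
  exact (hf.continuous_fderiv (by simp)).clm_apply continuous_const

lemma continuous_integral_slice {K : V3 → ℝ → ℝ}
    (hK : Continuous fun q : V3 × ℝ => K q.1 q.2) :
    Continuous fun s => ∫ x in Set.Icc (0 : V3) 1, K x s :=
  continuous_parametric_integral_of_continuous (f := fun s x => K x s)
    (hK.comp continuous_swap) isCompact_Icc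

lemma integral_deriv_time {K K' : V3 → ℝ → ℝ} (hK : Continuous fun q : V3 × ℝ => K q.1 q.2)
    (hK' : Continuous fun q : V3 × ℝ => K' q.1 q.2)
    (hd : ∀ x s, HasDerivAt (K x) (K' x s) s) (t : ℝ) :
    (∫ x in Set.Icc (0 : V3) 1, K x t) - ∫ x in Set.Icc (0 : V3) 1, K x 0
      = ∫ s in (0 : ℝ)..t, ∫ x in Set.Icc (0 : V3) 1, K' x s := by
  have hc : ∀ x, Continuous (K' x) := fun x => hK'.comp (Continuous.prodMk_right x)
  have hc' : ∀ s, Continuous fun x => K x s := fun s => hK.comp (Continuous.prodMk_left s)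
  rw [← unitCube_intervalIntegral_swap hK',
    ← integral_sub (hc' t).integrableOn_unitCube (hc' 0).integrableOn_unitCube]
  congr 1
  ext x
  rw [intervalIntegral.integral_eq_sub_of_hasDerivAt (fun s _ => hd x s)
    ((hc x).intervalIntegrable _ _)]

lemma integral_affine_le {a b d e g : ℝ → ℝ} {t c₁ c₂ c₃ c₄ c₅ : ℝ} (ht : 0 ≤ t)
    (ha : Continuous a) (hb : Continuous b) (hd : Continuous d) (he : Continuous e)
    (hg : Continuous g)
    (h : ∀ s ∈ Set.Icc (0 : ℝ) t,
      a s + c₁ * b s ≤ -(c₂ * d s) - c₃ * e s + c₄ + c₅ * g s) :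
    (∫ s in (0 : ℝ)..t, a s) + c₁ * (∫ s in (0 : ℝ)..t, b s)
      ≤ -(c₂ * ∫ s in (0 : ℝ)..t, d s) - c₃ * (∫ s in (0 : ℝ)..t, e s) + c₄ * t
        + c₅ * ∫ s in (0 : ℝ)..t, g s := by
  have hint := intervalIntegral.integral_mono_on (μ := volume) ht
    (Continuous.intervalIntegrable (u := fun s => a s + c₁ * b s) (by fun_prop) _ _)
    (Continuous.intervalIntegrable
      (u := fun s => -(c₂ * d s) - c₃ * e s + c₄ + c₅ * g s) (by fun_prop) _ _) h
  rw [intervalIntegral.integral_add (Continuous.intervalIntegrable (by fun_prop) _ _)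
      (Continuous.intervalIntegrable (by fun_prop) _ _),
    intervalIntegral.integral_add (Continuous.intervalIntegrable (by fun_prop) _ _)
      (Continuous.intervalIntegrable (by fun_prop) _ _),
    intervalIntegral.integral_add (Continuous.intervalIntegrable (by fun_prop) _ _)
      (Continuous.intervalIntegrable (by fun_prop) _ _),
    intervalIntegral.integral_sub (Continuous.intervalIntegrable (by fun_prop) _ _)
      (Continuous.intervalIntegrable (by fun_prop) _ _), intervalIntegral.integral_neg] at hint
  simp only [intervalIntegral.integral_const_mul, intervalIntegral.integral_const, smul_eq_mul,
    sub_zero] at hint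
  linarith

/-- energy estimate for the regularized Oldroyd-B model. -/
theorem energy_estimate (η : V3 → ℝ) (hη : ContDiff ℝ (⊤:ℕ∞) η)
    (hηsupp : HasCompactSupport η) (hηeven : ∀ x : V3, η (-x) = η x)
    (hηint : (∫ x : V3, η x) = 1)
    (α β γ δ ε : ℝ) (hα : 0 < α) (hβ : 0 < β) (hγ : 0 < γ)
    (hδ : 0 ≤ δ) (hε : 0 ≤ ε) :
    ∃ C : ℝ, 0 < C ∧ ∃ αbar : ℝ, 0 < αbar ∧ αbar ≤ α ∧
      EnergyInequality η α β γ δ ε C αbar := by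
  refine ⟨3 * β ^ 2 / (2 * α), by positivity, α / 2, by positivity, by linarith, ?_⟩
  rintro T hT u σ p F ⟨hu, hσ, hp, hF, hup, hσp, hpp, -, hsymm, hdiv, hmean, hequ, heqσ⟩ t ht
  have cu := fun i => (hu i).continuous
  have cσ := fun i j => (hσ i j).continuous
  have cF := fun i => (hF i).continuous
  have cu' := fun i => continuous_deriv_time (f := fun x s => u x s i) (hu i)
  have cσ' := fun i j => continuous_deriv_time (f := fun x s => σ x s i j) (hσ i j)
  have cpd := fun i j => continuous_pd_slice (f := fun x s => u x s i) (hu i) j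
  have hUD := uniqueDiffOn_Icc hT
  have hkin := integral_deriv_time (K := fun x s => ∑ i, (u x s i) ^ 2)
    (K' := fun x s => ∑ i, 2 * u x s i * deriv (fun r => u x r i) s) (by fun_prop) (by fun_prop)
    (fun x s => by
      refine HasDerivAt.fun_sum fun i _ => ?_
      simpa using (hasDerivAt_time (f := fun x s => u x s i) (hu i) x s).fun_pow 2) t
  have hel := integral_deriv_time (K := fun x s => ∑ i, σ x s i i)
    (K' := fun x s => ∑ i, deriv (fun r => σ x r i i) s) (by fun_prop) (by fun_prop)
    (fun x s => HasDerivAt.fun_sum fun i _ =>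
      hasDerivAt_time (f := fun x s => σ x s i i) (hσ i i) x s) t
  have ck := continuous_integral_slice
    (K := fun x s => ∑ i, 2 * u x s i * deriv (fun r => u x r i) s) (by fun_prop)
  have ce := continuous_integral_slice
    (K := fun x s => ∑ i, deriv (fun r => σ x r i i) s) (by fun_prop)
  have cD := continuous_integral_slice
    (K := fun x s => ∑ i, ∑ j, (pd j (fun y => u y s i) x) ^ 2) (by fun_prop)
  have ctr := continuous_integral_slice (K := fun x s => ∑ i, σ x s i i) (by fun_prop)
  have cG := continuous_integral_slice (K := fun x s => ∑ i, (F x s i) ^ 2) (by fun_prop)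
  have hstep : ∀ s ∈ Set.Icc (0 : ℝ) t,
      (∫ x in Set.Icc (0 : V3) 1, ∑ i, 2 * u x s i * deriv (fun r => u x r i) s)
        + β * (∫ x in Set.Icc (0 : V3) 1, ∑ i, deriv (fun r => σ x r i i) s)
      ≤ -(α * ∫ x in Set.Icc (0 : V3) 1, ∑ i, ∑ j, (pd j (fun y => u y s i) x) ^ 2)
        - β * γ * (∫ x in Set.Icc (0 : V3) 1, ∑ i, σ x s i i) + 3 * β * δ
        + 3 * β ^ 2 / (2 * α) * ∫ x in Set.Icc (0 : V3) 1, ∑ i, (F x s i) ^ 2 := by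
    intro s hs
    have hsT : s ∈ Set.Icc (0 : ℝ) T := ⟨hs.1, hs.2.trans ht.2⟩
    have h1 : ∀ x i, deriv (fun r => u x r i) s
        = velocityRHS η α β (fun i y => u y s i) (fun i j y => σ y s i j) (fun y => p y s)
          (fun i y => F y s i) i x := fun x i =>
      (hUD s hsT).eq_deriv _
        (hasDerivAt_time (f := fun x s => u x s i) (hu i) x s).hasDerivWithinAt (hequ x s hsT i)
    have h2 : ∀ x i, deriv (fun r => σ x r i i) s
        = stressDiagRHS η γ δ ε (fun i y => u y s i) (fun i j y => σ y s i j) i x := by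
      intro x i
      have := (hUD s hsT).eq_deriv _
        (hasDerivAt_time (f := fun x s => σ x s i i) (hσ i i) x s).hasDerivWithinAt
        (heqσ x s hsT i i)
      rw [this]
      simp [stressDiagRHS]
    simp_rw [h1, h2]
    exact energy_dissipation hη hηsupp hηeven β γ δ ε hα
      (fun i => contDiff_slice (f := fun x s => u x s i) (hu i) s)
      (fun i j => contDiff_slice (f := fun x s => σ x s i j) (hσ i j) s)
      (contDiff_slice (f := p) hp s)
      (fun i => (contDiff_slice (f := fun x s => F x s i) (hF i) s).continuous)
      (hup s) (hσp s) (hpp s) (fun i j x => (hsymm x s).apply j i) (fun x => hdiv x s) (hmean s)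
  have hint := integral_affine_le ht.1 ck ce cD ctr cG hstep
  rw [← hkin, ← hel] at hint
  linarith
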